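/- Let m ≥ 2 be even and suppose [m]_s = [m]_t = 0 in K. Then σ(π_{s,t}) = −[m−1]_s·π_{s,t} in the polynomial ring R = K[α_s, α_t] (note [m−1]_s = [m−1]_t since m−1 is odd). In particular, if additionally [m−1]_s = 1 (the even-balanced condition), then σ(π_{s,t}) = −π_{s,t}. -/

import Mathlib

open MvPolynomial

/-- The `K`-algebra automorphism `σ` of `R = K[α_s, α_t]` with `σ(α_s) = -α_s` and
`σ(α_t) = α_t + x_s·α_s` (here `α_s = X 0`, `α_t = X 1`). -/
noncomputable def sigP {K : Type*} [CommRing K] (xs : K) :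
    MvPolynomial (Fin 2) K →ₐ[K] MvPolynomial (Fin 2) K :=
  aeval (fun i : Fin 2 => if i = 0 then -X 0 else X 1 + C xs * X 0)

/-- The `K`-algebra automorphism `τ` of `R = K[α_s, α_t]` with `τ(α_s) = α_s + x_t·α_t`
and `τ(α_t) = -α_t`. -/
noncomputable def tauP {K : Type*} [CommRing K] (xt : K) :
    MvPolynomial (Fin 2) K →ₐ[K] MvPolynomial (Fin 2) K :=
  aeval (fun i : Fin 2 => if i = 0 then X 0 + C xt * X 1 else -X 1)

/-- The alternating composite `σ∘τ∘σ∘⋯` of `n` automorphisms, beginning with `σ`. -/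
noncomputable def wordST {K : Type*} [CommRing K] (xs xt : K) :
    ℕ → (MvPolynomial (Fin 2) K →ₐ[K] MvPolynomial (Fin 2) K)
  | 0 => AlgHom.id K _
  | n + 1 => (wordST xs xt n).comp (if Even n then sigP xs else tauP xt)

/-- The alternating composite `τ∘σ∘τ∘⋯` of `n` automorphisms, beginning with `τ`. -/
noncomputable def wordTS {K : Type*} [CommRing K] (xs xt : K) :
    ℕ → (MvPolynomial (Fin 2) K →ₐ[K] MvPolynomial (Fin 2) K)
  | 0 => AlgHom.id K _
  | n + 1 => (wordTS xs xt n).comp (if Even n then tauP xt else sigP xs)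

/-- `β_k`: the image of `α_s` (if `k` odd) or `α_t` (if `k` even) under the alternating
composite of `k-1` automorphisms beginning with `σ`. -/
noncomputable def betaP {K : Type*} [CommRing K] (xs xt : K) (k : ℕ) :
    MvPolynomial (Fin 2) K :=
  wordST xs xt (k - 1) (if Odd k then X 0 else X 1)

/-- `γ_k`: the image of `α_t` (if `k` odd) or `α_s` (if `k` even) under the alternating
composite of `k-1` automorphisms beginning with `τ`. -/
noncomputable def gammaP {K : Type*} [CommRing K] (xs xt : K) (k : ℕ) :
    MvPolynomial (Fin 2) K :=
  wordTS xs xt (k - 1) (if Odd k then X 1 else X 0)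

/-- `π_{s,t} = Π_{k=1}^m β_k`. -/
noncomputable def piST {K : Type*} [CommRing K] (xs xt : K) (m : ℕ) :
    MvPolynomial (Fin 2) K :=
  ∏ k ∈ Finset.range m, betaP xs xt (k + 1)

/-- `π_{t,s} = Π_{k=1}^m γ_k`. -/
noncomputable def piTS {K : Type*} [CommRing K] (xs xt : K) (m : ℕ) :
    MvPolynomial (Fin 2) K :=
  ∏ k ∈ Finset.range m, gammaP xs xt (k + 1)

section TwoColored

variable {K : Type*} [CommRing K] {xs xt : K} {qs qt : ℤ → K}

/-- Two-colored quantum numbers of odd index agree, and those of even index are proportional. -/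
lemma twoColored_parity (hqs0 : qs 0 = 0) (hqt0 : qt 0 = 0) (hqs1 : qs 1 = 1) (hqt1 : qt 1 = 1)
    (hrecs : ∀ n : ℤ, qs (n + 1) = xs * qt n - qs (n - 1))
    (hrect : ∀ n : ℤ, qt (n + 1) = xt * qs n - qt (n - 1)) (n : ℕ) :
    xt * qs (2 * n) = xs * qt (2 * n) ∧ qs (2 * n + 1) = qt (2 * n + 1) := by
  induction n with
  | zero => simp [hqs0, hqt0, hqs1, hqt1]
  | succ n ih =>
    obtain ⟨he, ho⟩ := ih
    have es := hrecs (2 * n + 1)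
    have et := hrect (2 * n + 1)
    have os := hrecs (2 * n + 1 + 1)
    have ot := hrect (2 * n + 1 + 1)
    simp only [add_sub_cancel_right] at es et os ot
    have hn : (2 * ((n + 1 : ℕ) : ℤ)) = 2 * n + 1 + 1 := by push_cast; ring
    rw [hn]
    have h : xt * qs (2 * n + 1 + 1) = xs * qt (2 * n + 1 + 1) := by
      rw [es, et, ho]
      linear_combination -he
    refine ⟨h, ?_⟩
    rw [os, ot, ho, h]

/-- The reflection `[m - k] = [m - 1] [k]` when `[m]` vanishes. -/
lemma twoColored_reflect (hqs0 : qs 0 = 0) (hqt0 : qt 0 = 0) (hqs1 : qs 1 = 1) (hqt1 : qt 1 = 1)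
    (hrecs : ∀ n : ℤ, qs (n + 1) = xs * qt n - qs (n - 1))
    (hrect : ∀ n : ℤ, qt (n + 1) = xt * qs n - qt (n - 1))
    {m : ℤ} (hms : qs m = 0) (hmt : qt m = 0) (hst : qs (m - 1) = qt (m - 1)) (k : ℕ) :
    (qs (m - k) = qs (m - 1) * qs k ∧ qt (m - k) = qs (m - 1) * qt k) ∧
      qs (m - (k + 1)) = qs (m - 1) * qs (k + 1) ∧
      qt (m - (k + 1)) = qs (m - 1) * qt (k + 1) := by
  induction k with
  | zero => simp [hqs0, hqt0, hqs1, hqt1, hms, hmt, hst]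
  | succ k ih =>
    obtain ⟨⟨hs0, ht0⟩, hs1, ht1⟩ := ih
    push_cast
    refine ⟨⟨hs1, ht1⟩, ?_, ?_⟩
    · have h := hrecs (m - (k + 1))
      have h' := hrecs (k + 1)
      rw [show m - ((k : ℤ) + 1) + 1 = m - k by ring,
        show m - ((k : ℤ) + 1) - 1 = m - (k + 1 + 1) by ring] at h
      rw [add_sub_cancel_right] at h'
      linear_combination h - hs0 + xs * ht1 - qs (m - 1) * h'
    · have h := hrect (m - (k + 1))
      have h' := hrect (k + 1)
      rw [show m - ((k : ℤ) + 1) + 1 = m - k by ring,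
        show m - ((k : ℤ) + 1) - 1 = m - (k + 1 + 1) by ring] at h
      rw [add_sub_cancel_right] at h'
      linear_combination h - ht0 + xt * hs1 - qs (m - 1) * h'

/-- The linear form `[n]_s α_s + [n-1]_t α_t`. -/
noncomputable def rootForm (qs qt : ℤ → K) (n : ℤ) : MvPolynomial (Fin 2) K :=
  C (qs n) * X 0 + C (qt (n - 1)) * X 1

lemma sigP_X_zero : sigP xs (X 0) = -X 0 := by simp [sigP]

lemma sigP_X_one : sigP xs (X 1) = X 1 + C xs * X 0 := by simp [sigP]

lemma tauP_X_zero : tauP xt (X 0) = X 0 + C xt * X 1 := by simp [tauP]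

lemma tauP_X_one : tauP xt (X 1) = -X 1 := by simp [tauP]

lemma sigP_rootForm (hrecs : ∀ n : ℤ, qs (n + 1) = xs * qt n - qs (n - 1)) (n : ℤ) :
    sigP xs (rootForm qs qt n) = C (qs (n - 2)) * X 0 + C (qt (n - 1)) * X 1 := by
  have h := congrArg (C (σ := Fin 2)) (hrecs (n - 1))
  rw [sub_add_cancel, show n - 1 - 1 = n - 2 by ring, C_sub, C_mul] at h
  simp only [rootForm, map_add, map_mul, algHom_C, algebraMap_eq, sigP_X_zero, sigP_X_one]
  linear_combination -X 0 * h

lemma wordST_X (hqs0 : qs 0 = 0) (hqt0 : qt 0 = 0) (hqs1 : qs 1 = 1) (hqt1 : qt 1 = 1)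
    (hrecs : ∀ n : ℤ, qs (n + 1) = xs * qt n - qs (n - 1))
    (hrect : ∀ n : ℤ, qt (n + 1) = xt * qs n - qt (n - 1)) (n : ℕ) :
    wordST xs xt n (if Even n then X 0 else X 1) = rootForm qs qt (n + 1) ∧
      wordST xs xt n (if Even n then X 1 else X 0) = -rootForm qs qt n := by
  induction n with
  | zero =>
    have h := hrect 0
    simp only [zero_add, hqt1, hqs0, zero_sub, mul_zero] at h
    have h' : qt (-1) = -1 := by rw [h, neg_neg]
    simp [wordST, rootForm, hqs0, hqt0, hqs1, h']
  | succ n ih =>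
    have parity := twoColored_parity hqs0 hqt0 hqs1 hqt1 hrecs hrect
    obtain ⟨h1, h2⟩ := ih
    have rs := congrArg (C (σ := Fin 2)) (hrecs (n + 1))
    have rt := congrArg (C (σ := Fin 2)) (hrect n)
    rw [add_sub_cancel_right] at rs
    simp only [C_sub, C_mul] at rs rt
    rcases Nat.even_or_odd n with hn | hn
    · have hn' : ¬ Even (n + 1) := by simpa [Nat.even_add_one] using hn
      simp only [hn, if_true] at h1 h2
      simp only [hn', if_false, wordST, hn, if_true, AlgHom.comp_apply, sigP_X_zero, sigP_X_one,
        map_add, map_mul, map_neg, algHom_C, algebraMap_eq, h1, h2]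
      refine ⟨?_, by push_cast; rfl⟩
      obtain ⟨j, rfl⟩ := hn
      obtain ⟨he, ho⟩ := parity j
      rw [show 2 * (j : ℤ) = (j + j : ℕ) by push_cast; ring] at he ho
      have he' := congrArg (C (σ := Fin 2)) he
      simp only [C_mul] at he'
      simp only [rootForm, Nat.cast_succ, add_sub_cancel_right, rs, ho]
      rw [rt]
      linear_combination -X 1 * he'
    · have hn0 : ¬ Even n := by simpa using hn
      have hn' : Even (n + 1) := by simpa [Nat.even_add_one] using hn
      simp only [hn0, if_false] at h1 h2
      simp only [hn', if_true, wordST, hn0, if_false, AlgHom.comp_apply, tauP_X_zero, tauP_X_one,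
        map_add, map_mul, map_neg, algHom_C, algebraMap_eq, h1, h2]
      refine ⟨?_, by push_cast; rfl⟩
      obtain ⟨j, rfl⟩ := hn
      obtain ⟨-, ho⟩ := parity j
      obtain ⟨he, -⟩ := parity (j + 1)
      rw [show 2 * (j : ℤ) + 1 = (2 * j + 1 : ℕ) by push_cast; ring] at ho
      rw [show 2 * ((j + 1 : ℕ) : ℤ) = (2 * j + 1 : ℕ) + 1 by push_cast; ring] at he
      have he' := congrArg (C (σ := Fin 2)) he
      simp only [C_mul] at he'
      simp only [rootForm, Nat.cast_succ, add_sub_cancel_right, rs]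
      rw [rt, ho]
      rw [rt, ho] at he'
      linear_combination X 0 * he'

lemma betaP_succ (hqs0 : qs 0 = 0) (hqt0 : qt 0 = 0) (hqs1 : qs 1 = 1) (hqt1 : qt 1 = 1)
    (hrecs : ∀ n : ℤ, qs (n + 1) = xs * qt n - qs (n - 1))
    (hrect : ∀ n : ℤ, qt (n + 1) = xt * qs n - qt (n - 1)) (n : ℕ) :
    betaP xs xt (n + 1) = rootForm qs qt (n + 1) := by
  rw [← (wordST_X hqs0 hqt0 hqs1 hqt1 hrecs hrect n).1]
  simp [betaP, Nat.odd_add_one]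

end TwoColored

/-- If `m ≥ 2` is even and `[m]_s = [m]_t = 0` in `K`, then
`σ(π_{s,t}) = -[m-1]_s·π_{s,t}` (note `[m-1]_s = [m-1]_t` since `m-1` is odd).
In particular, if moreover `[m-1]_s = 1` (even-balancedness), then
`σ(π_{s,t}) = -π_{s,t}`. -/
theorem sig_piST_of_even {K : Type*} [CommRing K] (xs xt : K) (qs qt : ℤ → K)
    (hqs0 : qs 0 = 0) (hqt0 : qt 0 = 0) (hqs1 : qs 1 = 1) (hqt1 : qt 1 = 1)
    (hrecs : ∀ n : ℤ, qs (n + 1) = xs * qt n - qs (n - 1))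
    (hrect : ∀ n : ℤ, qt (n + 1) = xt * qs n - qt (n - 1))
    (m : ℕ) (hm : 2 ≤ m) (hme : Even m) (hms : qs (m : ℤ) = 0) (hmt : qt (m : ℤ) = 0) :
    sigP xs (piST xs xt m) = -(MvPolynomial.C (qs ((m : ℤ) - 1)) * piST xs xt m) ∧
    (qs ((m : ℤ) - 1) = 1 → sigP xs (piST xs xt m) = -piST xs xt m) := by
  have parity := twoColored_parity hqs0 hqt0 hqs1 hqt1 hrecs hrect
  obtain ⟨j, rfl⟩ : ∃ j, m = 2 * j + 1 + 1 := by
    obtain ⟨i, rfl⟩ := hme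
    exact ⟨i - 1, by omega⟩
  have hm1 : (((2 * j + 1 + 1 : ℕ) : ℤ) - 1) = 2 * j + 1 := by push_cast; ring
  have hst : qs (((2 * j + 1 + 1 : ℕ) : ℤ) - 1) = qt (((2 * j + 1 + 1 : ℕ) : ℤ) - 1) := by
    rw [hm1]
    exact (parity j).2
  have reflect := twoColored_reflect hqs0 hqt0 hqs1 hqt1 hrecs hrect hms hmt hst
  set c := qs (((2 * j + 1 + 1 : ℕ) : ℤ) - 1) with hc
  have hcc : c * c = 1 := by
    have h := (reflect (2 * j + 1)).1.1
    rw [show ((2 * j + 1 + 1 : ℕ) : ℤ) - (2 * j + 1 : ℕ) = 1 by push_cast; ring, hqs1,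
      show ((2 * j + 1 : ℕ) : ℤ) = ((2 * j + 1 + 1 : ℕ) : ℤ) - 1 by push_cast; ring, ← hc] at h
    exact h.symm
  have hpow : c ^ (2 * j + 1) = c := by
    rw [pow_succ, pow_mul, pow_two, hcc, one_pow, one_mul]
  have hfirst : sigP xs (rootForm qs qt 1) = -rootForm qs qt 1 := by
    simp [rootForm, hqs1, hqt0, sigP_X_zero]
  have hsig : ∀ k ∈ Finset.range (2 * j + 1),
      sigP xs (rootForm qs qt ((k + 1 : ℕ) + 1)) =
        C c * rootForm qs qt ((2 * j + 1 - 1 - k + 1 : ℕ) + 1) := by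
    intro k hk
    have hk' : k ≤ 2 * j := by simpa [Nat.lt_succ_iff] using hk
    obtain ⟨⟨hs, -⟩, -, ht⟩ := reflect k
    rw [sigP_rootForm hrecs, rootForm,
      show ((2 * j + 1 - 1 - k + 1 : ℕ) : ℤ) + 1 = ((2 * j + 1 + 1 : ℕ) : ℤ) - k by omega,
      show ((2 * j + 1 + 1 : ℕ) : ℤ) - k - 1 = ((2 * j + 1 + 1 : ℕ) : ℤ) - (k + 1) by ring,
      hs, ht, mul_add, ← mul_assoc, ← mul_assoc, ← C_mul, ← C_mul, ← mul_assoc, ← mul_assoc,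
      hcc, one_mul, one_mul]
    congr 4 <;> push_cast <;> ring
  have main : sigP xs (piST xs xt (2 * j + 1 + 1)) =
      -(C c * piST xs xt (2 * j + 1 + 1)) := by
    simp only [piST, betaP_succ hqs0 hqt0 hqs1 hqt1 hrecs hrect]
    rw [Finset.prod_range_succ', map_mul, map_prod, Finset.prod_congr rfl hsig,
      Finset.prod_mul_distrib, Finset.prod_const, Finset.card_range, ← C_pow, hpow,
      Finset.prod_range_reflect (fun k : ℕ => rootForm qs qt ((k + 1 : ℕ) + 1)), Nat.cast_zero,
      zero_add, hfirst]
    ring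
  refine ⟨main, fun h => ?_⟩
  rw [main, h, C_1, one_mul]
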